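/- In the closed set packing construction S' = {Sᵢ ∪ {eᵢ}} with fresh distinct markers e₁,…,eₙ ∉ U, every set packing of (U', S') is automatically a closed set packing of (U', S'); hence closed set packings of (U', S') correspond exactly to set packings of (U, S) via Sᵢ ↦ Sᵢ ∪ {eᵢ}. -/

import Mathlib

/-- `P` (a set of indices) is a set packing of the family `S`: the selected sets are
pairwise disjoint. -/
def IsSetPacking {α : Type} [DecidableEq α] {n : ℕ} (S : Fin n → Finset α)
    (P : Finset (Fin n)) : Prop :=
  ∀ i ∈ P, ∀ j ∈ P, i ≠ j → Disjoint (S i) (S j)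

/-- A closed set packing: a set packing such that no unselected member of the family
is contained in the union of the selected ones. -/
def IsClosedSetPacking {α : Type} [DecidableEq α] {n : ℕ} (S : Fin n → Finset α)
    (P : Finset (Fin n)) : Prop :=
  IsSetPacking S P ∧ ∀ j, j ∉ P → ¬ S j ⊆ P.sup S

/-- A maximum-cardinality set packing. -/
def IsMaxSetPacking {α : Type} [DecidableEq α] {n : ℕ} (S : Fin n → Finset α)
    (P : Finset (Fin n)) : Prop :=
  IsSetPacking S P ∧ ∀ Q, IsSetPacking S Q → Q.card ≤ P.card

/-- A maximum-cardinality closed set packing. -/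
def IsMaxClosedSetPacking {α : Type} [DecidableEq α] {n : ℕ} (S : Fin n → Finset α)
    (P : Finset (Fin n)) : Prop :=
  IsClosedSetPacking S P ∧ ∀ Q, IsClosedSetPacking S Q → Q.card ≤ P.card

theorem stmt19 {α : Type} [DecidableEq α] {n : ℕ} (U : Finset α)
    (S : Fin n → Finset α) (hS : ∀ i, S i ⊆ U)
    (e : Fin n → α) (he : Function.Injective e) (heU : ∀ i, e i ∉ U) :
    (∀ P, IsSetPacking (fun i => insert (e i) (S i)) P →
        IsClosedSetPacking (fun i => insert (e i) (S i)) P) ∧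
    (∀ P, IsSetPacking S P ↔ IsClosedSetPacking (fun i => insert (e i) (S i)) P) := by
  have key : ∀ P, IsSetPacking (fun i => insert (e i) (S i)) P →
      IsClosedSetPacking (fun i => insert (e i) (S i)) P := by
    intro P hP
    refine ⟨hP, fun j hj hsub => ?_⟩
    have h1 : e j ∈ P.sup (fun i => insert (e i) (S i)) :=
      hsub (Finset.mem_insert_self _ _)
    obtain ⟨i, hi, hmem⟩ := Finset.mem_sup.mp h1
    rcases Finset.mem_insert.mp hmem with h | h
    · exact hj (he h ▸ hi)
    · exact heU j (hS i h)
  refine ⟨key, fun P => ⟨fun hP => key P ?_, fun hP i hi j hj hij => ?_⟩⟩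
  · intro i hi j hj hij
    have hd := hP i hi j hj hij
    rw [Finset.disjoint_left] at hd ⊢
    intro x hx hx'
    rcases Finset.mem_insert.mp hx with rfl | h
    · rcases Finset.mem_insert.mp hx' with h' | h'
      · exact hij (he h')
      · exact heU i (hS j h')
    · rcases Finset.mem_insert.mp hx' with rfl | h'
      · exact heU j (hS i h)
      · exact hd h h'
  · exact (hP.1 i hi j hj hij).mono (Finset.subset_insert _ _) (Finset.subset_insert _ _)
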